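/- arXiv:0909.5352 — 3 statements merged into one kernel-verified Lean document; each statement's English description precedes it below -/
import Mathlib

section
/- Every Weber hexad in V = F_2^4 containing the element 0 is, under the identification of V with even partitions of {1,...,6}, of the form {0, [ij], [jk], [kl], [lm], [mi]} for distinct indices i,j,k,l,m in {1,...,6}. -/
/-- `V` = partitions of {1,…,6} into two even-size parts, represented by the
part of size 0 or 2. -/
def isV (s : Finset (Fin 6)) : Prop := s.card = 0 ∨ s.card = 2

/-- Addition on `V`: normalized symmetric difference. -/
def vadd (a b : Finset (Fin 6)) : Finset (Fin 6) :=
  if (symmDiff a b).card = 4 then (symmDiff a b)ᶜ else symmDiff a b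

/-- The intersection-parity symplectic form `b([α],[α']) = #(α ∩ α') mod 2`. -/
def bform (a b : Finset (Fin 6)) : ZMod 2 := ((a ∩ b).card : ZMod 2)

/-- A 2-dimensional subspace of `V = F_2^4`: a subgroup with 4 elements. -/
def IsSubspace2 (S : Finset (Finset (Fin 6))) : Prop :=
  S.card = 4 ∧ (∀ a ∈ S, isV a) ∧ ∅ ∈ S ∧ ∀ a ∈ S, ∀ b ∈ S, vadd a b ∈ S

/-- A Göpel subgroup: a totally isotropic 2-dimensional subspace. -/
def IsGopelSubgroup (S : Finset (Finset (Fin 6))) : Prop :=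
  IsSubspace2 S ∧ ∀ a ∈ S, ∀ b ∈ S, bform a b = 0

/-- A Rosenhain subgroup: a 2-dimensional subspace which is not totally isotropic. -/
def IsRosenhainSubgroup (S : Finset (Finset (Fin 6))) : Prop :=
  IsSubspace2 S ∧ ∃ a ∈ S, ∃ b ∈ S, bform a b ≠ 0

/-- A Göpel tetrad: a coset (translate) of a Göpel subgroup. -/
def IsGopelTetrad (t : Finset (Finset (Fin 6))) : Prop :=
  ∃ S v, IsGopelSubgroup S ∧ isV v ∧ t = S.image (vadd v)

/-- A Rosenhain tetrad: a coset (translate) of a Rosenhain subgroup. -/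
def IsRosenhainTetrad (t : Finset (Finset (Fin 6))) : Prop :=
  ∃ S v, IsRosenhainSubgroup S ∧ isV v ∧ t = S.image (vadd v)

/-- A Weber hexad: a 6-element set which is the symmetric difference of a
Göpel tetrad and a Rosenhain tetrad. -/
def IsWeberHexad (w : Finset (Finset (Fin 6))) : Prop :=
  w.card = 6 ∧ ∃ G R, IsGopelTetrad G ∧ IsRosenhainTetrad R ∧ w = symmDiff G R

/-- Coordinates on `V`. -/
def eV : Fin 16 → Finset (Fin 6) :=
  ![∅, {0, 1}, {1, 2}, {0, 2}, {2, 3}, {4, 5}, {1, 3}, {0, 3}, {3, 4}, {2, 5}, {0, 5}, {1, 5}, {2, 4}, {3, 5}, {1, 4}, {0, 4}]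

def pV : Fin 6 → Fin 16 := ![0, 1, 3, 7, 15, 10]

def tetM (v a b : Fin 16) : ℕ :=
  2 ^ v.val ||| (2 ^ (v ^^^ a).val ||| (2 ^ (v ^^^ b).val ||| (2 ^ (v ^^^ (a ^^^ b)).val ||| 0)))

def pentM (i j k l m : Fin 6) : ℕ :=
  2 ^ (0 : Fin 16).val ||| (2 ^ (pV i ^^^ pV j).val ||| (2 ^ (pV j ^^^ pV k).val |||
    (2 ^ (pV k ^^^ pV l).val ||| (2 ^ (pV l ^^^ pV m).val ||| (2 ^ (pV m ^^^ pV i).val ||| 0)))))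

def bitN (m i : ℕ) : ℕ := if m.testBit i then 1 else 0

def popN (m : ℕ) : ℕ :=
  bitN m 0 + (bitN m 1 + (bitN m 2 + (bitN m 3 + (bitN m 4 + (bitN m 5 + (bitN m 6 + (bitN m 7 +
  (bitN m 8 + (bitN m 9 + (bitN m 10 + (bitN m 11 + (bitN m 12 + (bitN m 13 + (bitN m 14 +
  bitN m 15))))))))))))))

/-- Masks of the Göpel tetrads, the Rosenhain tetrads and the hexads through zero. -/
def gL : List ℕ :=
  [51, 90, 105, 150, 165, 204, 771, 816, 1285, 1440, 1542, 1680, 2313, 2400, 2570, 2640,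
   3084, 3264, 4420, 4488, 5160, 5185, 6180, 6273, 8772, 8840, 9240, 9282, 10260, 10370,
   12291, 12336, 13056, 16660, 16770, 16932, 17025, 17425, 17442, 20490, 20560, 23040,
   24585, 24672, 26880, 33048, 33090, 33320, 33345, 34833, 34850, 36870, 37008, 38400,
   40965, 41120, 42240, 49164, 49344, 52224]

def rL : List ℕ :=
  [15, 60, 85, 102, 153, 170, 195, 240, 780, 960, 1290, 1360, 1545, 1632, 2310, 2448,
   2565, 2720, 3075, 3120, 3840, 4369, 4386, 4626, 4641, 4680, 4740, 5140, 5250, 6168,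
   6210, 8466, 8481, 8520, 8580, 8721, 8738, 9252, 9345, 10280, 10305, 12300, 12480,
   15360, 16680, 16705, 16920, 16962, 17476, 17544, 18450, 18465, 18504, 18564, 20485,
   20640, 21760, 24582, 24720, 26112, 33060, 33153, 33300, 33410, 33810, 33825, 33864,
   33924, 34884, 34952, 36873, 36960, 39168, 40970, 41040, 43520, 49155, 49200, 49920,
   61440]

def wL : List ℕ :=
  [869, 937, 1337, 1379, 1619, 1733, 2357, 2467, 2707, 2761, 3161, 3221, 4427, 4487, 5159,
   5297, 6017, 6187, 6257, 6977, 8779, 8839, 9239, 9293, 10267, 10381, 12389, 12457,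
   13577, 14597, 16667, 16781, 16939, 17009, 17453, 17633, 19217, 19841, 20627, 20681,
   22019, 23561, 24629, 24739, 25349, 25859, 29249, 30737, 33047, 33101, 33319, 33457,
   34577, 34861, 35041, 36161, 36947, 37061, 39427, 39941, 41017, 41059, 41737, 43267,
   45697, 46097, 49241, 49301, 50693, 51721, 58433, 59521]


def dec (m : ℕ) : Finset (Finset (Fin 6)) :=
  (Finset.univ.filter (fun i : Fin 16 => m.testBit i.val = true)).image eV

lemma eV_inj : Function.Injective eV := by
  have h : ∀ i j, eV i = eV j → i = j := by decide +kernel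
  exact fun i j => h i j

lemma eV_surj : ∀ s, isV s → ∃ i, eV i = s := by
  unfold isV; decide +kernel

lemma eV_add : ∀ i j, vadd (eV i) (eV j) = eV (i ^^^ j) := by decide +kernel

lemma eV_zero : eV 0 = ∅ := rfl

lemma eV_pair : ∀ i j : Fin 6, i ≠ j → eV (pV i ^^^ pV j) = {i, j} := by decide +kernel

lemma dec_zero : dec 0 = ∅ := by simp [dec]

lemma dec_or (a : Fin 16) (m : ℕ) : dec (2 ^ a.val ||| m) = insert (eV a) (dec m) := by
  unfold dec
  rw [← Finset.image_insert]
  congr 1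
  ext i
  by_cases h : i = a
  · subst h
    simp [Nat.testBit_or]
  · have h' : ¬ (a.val = i.val) := fun h2 => h (Fin.ext h2.symm)
    simp [Nat.testBit_or, Nat.testBit_two_pow, h, h']

lemma mem_dec (m : ℕ) (s : Finset (Fin 6)) :
    s ∈ dec m ↔ ∃ i : Fin 16, m.testBit i.val = true ∧ eV i = s := by
  simp [dec]

lemma eV_mem_dec (m : ℕ) (i : Fin 16) : eV i ∈ dec m ↔ m.testBit i.val = true := by
  rw [mem_dec]
  constructor
  · rintro ⟨j, hj, h⟩
    rwa [← eV_inj h]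
  · exact fun h => ⟨i, h, rfl⟩

lemma dec_xor (m n : ℕ) : symmDiff (dec m) (dec n) = dec (m ^^^ n) := by
  ext s
  by_cases hs : ∃ i, eV i = s
  · obtain ⟨i, rfl⟩ := hs
    simp only [Finset.mem_symmDiff, eV_mem_dec, Nat.testBit_xor]
    cases m.testBit i.val <;> cases n.testBit i.val <;> simp
  · have h : ∀ k, s ∉ dec k := by
      intro k hk
      obtain ⟨i, -, hi⟩ := (mem_dec k s).1 hk
      exact hs ⟨i, hi⟩
    simp [Finset.mem_symmDiff, h]

lemma dec_card (m : ℕ) : (dec m).card = popN m := by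
  unfold dec
  rw [Finset.card_image_of_injective _ eV_inj, Finset.card_filter]
  simp only [Fin.sum_univ_succ, popN, bitN]
  rfl

lemma sub_eq (S : Finset (Finset (Fin 6))) (hS : IsSubspace2 S) (i j : Fin 16)
    (hi : i ≠ 0) (hj : j ≠ 0) (hij : i ≠ j) (hiS : eV i ∈ S) (hjS : eV j ∈ S) :
    S = {eV 0, eV i, eV j, eV (i ^^^ j)} := by
  obtain ⟨hc, -, h0, hadd⟩ := hS
  symm
  apply Finset.eq_of_subset_of_card_le
  · intro x hx
    simp only [Finset.mem_insert, Finset.mem_singleton] at hx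
    rcases hx with rfl | rfl | rfl | rfl
    · exact h0
    · exact hiS
    · exact hjS
    · rw [← eV_add]; exact hadd _ hiS _ hjS
  · have h : ∀ i j : Fin 16, i ≠ 0 → j ≠ 0 → i ≠ j →
        ({0, i, j, i ^^^ j} : Finset (Fin 16)).card = 4 := by decide +kernel
    have h2 := h i j hi hj hij
    rw [← Finset.card_image_of_injective _ eV_inj] at h2
    simp only [Finset.image_insert, Finset.image_singleton] at h2
    rw [h2, hc]

lemma tet_eq (v i j : Fin 16) :
    (({eV 0, eV i, eV j, eV (i ^^^ j)} : Finset (Finset (Fin 6))).image (vadd (eV v)))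
      = dec (tetM v i j) := by
  have h : v ^^^ 0 = v := by revert v; decide
  simp only [Finset.image_insert, Finset.image_singleton, eV_add, tetM, dec_or, dec_zero, h]
  rfl

lemma gopel_mem : ∀ i j : Fin 16, i ≠ 0 → j ≠ 0 → i ≠ j → bform (eV i) (eV j) = 0 →
    ∀ v, tetM v i j ∈ gL := by decide +kernel

lemma rosen_mem : ∀ i j : Fin 16, bform (eV i) (eV j) ≠ 0 →
    i ≠ 0 ∧ j ≠ 0 ∧ i ≠ j ∧ ∀ v, tetM v i j ∈ rL := by decide +kernel

lemma gopel_dec (t : Finset (Finset (Fin 6))) (ht : IsGopelTetrad t) : ∃ g ∈ gL, t = dec g := by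
  obtain ⟨S, v, ⟨hS, hb⟩, hv, rfl⟩ := ht
  obtain ⟨v, rfl⟩ := eV_surj v hv
  obtain ⟨a, haS, ha⟩ := Finset.exists_mem_notMem_of_card_lt_card
    (s := {∅}) (t := S) (by rw [hS.1]; simp)
  obtain ⟨b, hbS, hb'⟩ := Finset.exists_mem_notMem_of_card_lt_card
    (s := {∅, a}) (t := S) (by rw [hS.1]; exact lt_of_le_of_lt Finset.card_le_two (by norm_num))
  obtain ⟨i, rfl⟩ := eV_surj a (hS.2.1 a haS)
  obtain ⟨j, rfl⟩ := eV_surj b (hS.2.1 b hbS)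
  simp only [Finset.mem_insert, Finset.mem_singleton, not_or, ← eV_zero, eV_inj.eq_iff] at ha hb'
  refine ⟨tetM v i j, gopel_mem i j ha hb'.1 (Ne.symm hb'.2) (hb _ haS _ hbS) v, ?_⟩
  rw [sub_eq S hS i j ha hb'.1 (Ne.symm hb'.2) haS hbS, tet_eq]

lemma rosen_dec (t : Finset (Finset (Fin 6))) (ht : IsRosenhainTetrad t) :
    ∃ r ∈ rL, t = dec r := by
  obtain ⟨S, v, ⟨hS, a, haS, b, hbS, hab⟩, hv, rfl⟩ := ht
  obtain ⟨v, rfl⟩ := eV_surj v hv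
  obtain ⟨i, rfl⟩ := eV_surj a (hS.2.1 a haS)
  obtain ⟨j, rfl⟩ := eV_surj b (hS.2.1 b hbS)
  obtain ⟨hi, hj, hij, h⟩ := rosen_mem i j hab
  refine ⟨tetM v i j, h v, ?_⟩
  rw [sub_eq S hS i j hi hj hij haS hbS, tet_eq]

lemma hexad_mem : ∀ g ∈ gL, ∀ r ∈ rL, (g ^^^ r).testBit 0 = true → popN (g ^^^ r) = 6 →
    g ^^^ r ∈ wL := by decide +kernel

lemma hexad_pent : ∀ w ∈ wL, ∃ i j k l m : Fin 6, w = pentM i j k l m ∧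
    ([i, j, k, l, m] : List (Fin 6)).Nodup := by decide +kernel

/-- every Weber hexad containing 0 has the form
`{0, [ij], [jk], [kl], [lm], [mi]}` for distinct indices i,j,k,l,m. -/
theorem weber_hexad_containing_zero (w : Finset (Finset (Fin 6)))
    (hw : IsWeberHexad w) (h0 : (∅ : Finset (Fin 6)) ∈ w) :
    ∃ i j k l m : Fin 6, ([i, j, k, l, m] : List (Fin 6)).Nodup ∧
      w = {∅, {i, j}, {j, k}, {k, l}, {l, m}, {m, i}} := by
  obtain ⟨hc, G, R, hG, hR, rfl⟩ := hw
  obtain ⟨g, hg, rfl⟩ := gopel_dec G hG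
  obtain ⟨r, hr, rfl⟩ := rosen_dec R hR
  rw [dec_xor] at *
  rw [dec_card] at hc
  rw [← eV_zero, eV_mem_dec] at h0
  obtain ⟨i, j, k, l, m, h, hn⟩ := hexad_pent _ (hexad_mem g hg r hr h0 hc)
  refine ⟨i, j, k, l, m, hn, ?_⟩
  simp only [List.nodup_cons, List.mem_cons, not_or, List.not_mem_nil] at hn
  obtain ⟨⟨hij, -, -, him, -⟩, ⟨hjk, -⟩, ⟨hkl, -⟩, ⟨hlm, -⟩, -⟩ := hn
  rw [h]
  simp only [pentM, dec_or, dec_zero]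
  rw [eV_pair i j hij, eV_pair j k hjk, eV_pair k l hkl, eV_pair l m hlm,
    eV_pair m i (Ne.symm him), eV_zero]
  rfl
end

section
/- Let (A,q) = u(2)^m ⊕ ⟨1/4⟩ be the finite quadratic form which is the orthogonal sum of m copies of the discriminant form of U(2) and the discriminant form of the rank-one lattice ⟨4⟩. Then the action of the orthogonal group O(q) on A has exactly 6 orbits, with representatives 0, 2g, e, e+f, g, e+f+g of sizes 1, 1, 2^{2m}−1, 2^{2m}−1, 2^{2m}+2^m, 2^{2m}−2^m respectively, where {e,f} is a standard generator of one u(2) summand (q(e)=q(f)=0, b(e,f)=1/2) and g generates the ⟨1/4⟩ summand. -/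
/-- Underlying group of the finite quadratic form `u(2)^m ⊕ ⟨1/4⟩`. -/
abbrev FQF (m : ℕ) : Type := (Fin m → ZMod 2 × ZMod 2) × ZMod 4

/-- The quadratic form `u(2)^m ⊕ ⟨1/4⟩` with values in `ℚ/2ℤ`:
each `u(2)` summand has `q(e)=q(f)=0`, `b(e,f)=1/2`, and the `⟨1/4⟩` summand
has `q(g)=1/4`. -/
def qFQF {m : ℕ} (x : FQF m) : AddCircle (2 : ℚ) :=
  (((∑ i, ((x.1 i).1.val : ℚ) * ((x.1 i).2.val : ℚ)) + ((x.2.val : ℚ))^2 / 4 : ℚ) :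
    AddCircle (2 : ℚ))

/-- `y` is in the `O(q)`-orbit of `x`. -/
def inOrbit {m : ℕ} (x y : FQF m) : Prop :=
  ∃ σ : FQF m ≃+ FQF m, (∀ z, qFQF (σ z) = qFQF z) ∧ σ x = y

/-- Standard generators `e`, `f` of one `u(2)` summand and `g` of `⟨1/4⟩`. -/
def eElt (m : ℕ) : FQF m := (fun i => if i.val = 0 then (1, 0) else 0, 0)
def fElt (m : ℕ) : FQF m := (fun i => if i.val = 0 then (0, 1) else 0, 0)
def gElt (m : ℕ) : FQF m := (0, 1)

namespace FQFaux

/-- quadratic form on the elementary abelian part -/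
def Q {m : ℕ} (v : Fin m → ZMod 2 × ZMod 2) : ZMod 2 := ∑ i, (v i).1 * (v i).2

/-- polar form of `Q` -/
def B {m : ℕ} (v w : Fin m → ZMod 2 × ZMod 2) : ZMod 2 :=
  ∑ i, ((v i).1 * (w i).2 + (v i).2 * (w i).1)

/-- combine the two components to a value in `ℤ/8` -/
def cmb (a : ZMod 2) (c : ZMod 4) : ZMod 8 := 4 * (a.val : ZMod 8) + (c.val : ZMod 8) ^ 2

/-- four times the quadratic form -/
def q8 {m : ℕ} (x : FQF m) : ZMod 8 := cmb (Q x.1) x.2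

/-- the embedding `ℤ/2 → ℤ/4` -/
def io (a : ZMod 2) : ZMod 4 := 2 * (a.val : ZMod 4)

/-- reduction `ℤ/4 → ℤ/2` -/
def rd (c : ZMod 4) : ZMod 2 := (c.val : ZMod 2)

lemma io_add : ∀ a b, io (a + b) = io a + io b := by decide
lemma rd_add : ∀ a b, rd (a + b) = rd a + rd b := by decide
lemma rd_io : ∀ a, rd (io a) = 0 := by decide

lemma q8_eq_nat {m : ℕ} (x : FQF m) :
    q8 x = ((4 * (∑ i, (x.1 i).1.val * (x.1 i).2.val) + x.2.val ^ 2 : ℕ) : ZMod 8) := by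
  have h : ∀ s : Finset (Fin m),
      4 * ((∑ i ∈ s, (x.1 i).1 * (x.1 i).2 : ZMod 2).val : ZMod 8)
        = 4 * ∑ i ∈ s, (((x.1 i).1.val : ZMod 8) * ((x.1 i).2.val : ZMod 8)) := by
    intro s
    induction s using Finset.induction_on with
    | empty => simp
    | insert a s ha ih =>
      rw [Finset.sum_insert ha, Finset.sum_insert ha, mul_add, ← ih]
      have : ∀ p r t : ZMod 2, 4 * ((p * r + t).val : ZMod 8)
          = 4 * ((p.val : ZMod 8) * (r.val : ZMod 8)) + 4 * (t.val : ZMod 8) := by decide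
      exact this _ _ _
  unfold q8 cmb Q
  rw [h]
  push_cast
  rfl

lemma q_iff {m : ℕ} (x y : FQF m) : qFQF x = qFQF y ↔ q8 x = q8 y := by
  rw [q8_eq_nat, q8_eq_nat]
  generalize hN : (4 * (∑ i, (x.1 i).1.val * (x.1 i).2.val) + x.2.val ^ 2 : ℕ) = N
  generalize hM : (4 * (∑ i, (y.1 i).1.val * (y.1 i).2.val) + y.2.val ^ 2 : ℕ) = M
  have hx : qFQF x = (((N : ℚ) / 4 : ℚ) : AddCircle (2 : ℚ)) := by
    unfold qFQF; congr 1; rw [← hN]; push_cast; ring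
  have hy : qFQF y = (((M : ℚ) / 4 : ℚ) : AddCircle (2 : ℚ)) := by
    unfold qFQF; congr 1; rw [← hM]; push_cast; ring
  rw [hx, hy, ← sub_eq_zero, ← AddCircle.coe_sub, AddCircle.coe_eq_zero_iff]
  have e : ((N : ZMod 8) = M) ↔ ((8 : ℤ) ∣ (N : ℤ) - M) := by
    rw [← sub_eq_zero]
    have := ZMod.intCast_zmod_eq_zero_iff_dvd ((N : ℤ) - M) 8
    push_cast at this
    exact this
  rw [e]
  constructor
  · rintro ⟨n, hn⟩
    refine ⟨n, ?_⟩
    have : ((N : ℚ) - M) = 8 * n := by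
      rw [zsmul_eq_mul] at hn; linarith
    exact_mod_cast this
  · rintro ⟨n, hn⟩
    refine ⟨n, ?_⟩
    have : ((N : ℚ) - M) = 8 * n := by exact_mod_cast hn
    rw [zsmul_eq_mul]; linarith

lemma B_add_left {m : ℕ} (v v' w : Fin m → ZMod 2 × ZMod 2) :
    B (v + v') w = B v w + B v' w := by
  unfold B
  rw [← Finset.sum_add_distrib]
  refine Finset.sum_congr rfl fun i _ => ?_
  simp only [Pi.add_apply, Prod.fst_add, Prod.snd_add]; ring

lemma B_comm {m : ℕ} (v w : Fin m → ZMod 2 × ZMod 2) : B v w = B w v := by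
  unfold B
  refine Finset.sum_congr rfl fun i _ => ?_
  ring

lemma B_smul_left {m : ℕ} (a : ZMod 2) (v w : Fin m → ZMod 2 × ZMod 2) :
    B (a • v) w = a * B v w := by
  unfold B
  rw [Finset.mul_sum]
  refine Finset.sum_congr rfl fun i _ => ?_
  simp only [Pi.smul_apply, Prod.smul_fst, Prod.smul_snd, smul_eq_mul]; ring

lemma B_self {m : ℕ} (v : Fin m → ZMod 2 × ZMod 2) : B v v = 0 := by
  unfold B
  refine Finset.sum_eq_zero fun i _ => ?_
  generalize v i = p
  revert p; decide

lemma Q_add {m : ℕ} (v w : Fin m → ZMod 2 × ZMod 2) : Q (v + w) = Q v + Q w + B v w := by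
  unfold B Q
  rw [← Finset.sum_add_distrib, ← Finset.sum_add_distrib]
  refine Finset.sum_congr rfl fun i _ => ?_
  simp only [Pi.add_apply, Prod.fst_add, Prod.snd_add]; ring

lemma Q_smul {m : ℕ} (a : ZMod 2) (v : Fin m → ZMod 2 × ZMod 2) : Q (a • v) = a * Q v := by
  unfold Q
  rw [Finset.mul_sum]
  refine Finset.sum_congr rfl fun i _ => ?_
  simp only [Pi.smul_apply, Prod.smul_fst, Prod.smul_snd, smul_eq_mul]
  generalize v i = p
  revert a p; decide

lemma add_self_V {m : ℕ} (v : Fin m → ZMod 2 × ZMod 2) : v + v = 0 := by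
  funext i
  simp only [Pi.add_apply, Pi.zero_apply]
  generalize v i = p
  revert p; decide

lemma exists_B {m : ℕ} (v : Fin m → ZMod 2 × ZMod 2) (hv : v ≠ 0) : ∃ w, B v w = 1 := by
  obtain ⟨i, hi⟩ := Function.ne_iff.mp hv
  have key : ∀ p : ZMod 2 × ZMod 2, p ≠ 0 → ∃ r : ZMod 2 × ZMod 2,
    p.1 * r.2 + p.2 * r.1 = 1 := by decide
  obtain ⟨r, hr⟩ := key (v i) hi
  refine ⟨Pi.single i r, ?_⟩
  unfold B
  rw [Finset.sum_eq_single i]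
  · simpa using hr
  · intro j _ hj
    simp [Pi.single_eq_of_ne hj]
  · simp

lemma exists_B2 {m : ℕ} (v w : Fin m → ZMod 2 × ZMod 2) (hv : v ≠ 0) (hw : w ≠ 0) :
    ∃ z, B v z = 1 ∧ B w z = 1 := by
  obtain ⟨a, ha⟩ := exists_B v hv
  obtain ⟨b, hb⟩ := exists_B w hw
  have two : ∀ t : ZMod 2, t ≠ 1 → t = 0 := by decide
  by_cases h1 : B w a = 1
  · exact ⟨a, ha, h1⟩
  by_cases h2 : B v b = 1
  · exact ⟨b, h2, hb⟩
  refine ⟨a + b, ?_, ?_⟩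
  · rw [B_comm, B_add_left, B_comm a, B_comm b, ha, two _ h2, add_zero]
  · rw [B_comm, B_add_left, B_comm a, B_comm b, hb, two _ h1, zero_add]

/-- coefficient of the reflection -/
def sc {m : ℕ} (u : Fin m → ZMod 2 × ZMod 2) (x : FQF m) : ZMod 2 :=
  B x.1 u + rd x.2 * (1 + Q u)

/-- reflection in `(u, 2(1+Q u))` -/
def T {m : ℕ} (u : Fin m → ZMod 2 × ZMod 2) (x : FQF m) : FQF m :=
  (x.1 + sc u x • u, x.2 + io (sc u x * (1 + Q u)))

lemma sc_add {m : ℕ} (u : Fin m → ZMod 2 × ZMod 2) (x y : FQF m) :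
    sc u (x + y) = sc u x + sc u y := by
  unfold sc
  rw [Prod.fst_add, Prod.snd_add, B_add_left, rd_add]; ring

lemma T_add {m : ℕ} (u : Fin m → ZMod 2 × ZMod 2) (x y : FQF m) :
    T u (x + y) = T u x + T u y := by
  unfold T
  rw [sc_add, add_smul, add_mul, io_add]
  ext1
  · simp only [Prod.fst_add]; abel
  · simp only [Prod.snd_add]; abel

lemma sc_T {m : ℕ} (u : Fin m → ZMod 2 × ZMod 2) (x : FQF m) : sc u (T u x) = sc u x := by
  conv_lhs => unfold sc T
  simp only [B_add_left, B_smul_left, B_self, rd_add, rd_io, mul_zero, add_zero]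
  rfl

lemma T_T {m : ℕ} (u : Fin m → ZMod 2 × ZMod 2) (x : FQF m) : T u (T u x) = x := by
  have h : T u (T u x) = ((T u x).1 + sc u x • u, (T u x).2 + io (sc u x * (1 + Q u))) := by
    rw [← sc_T u x, T, sc_T]
  rw [h]
  ext1
  · simp only [T, add_assoc, add_self_V, add_zero]
  · have : ∀ a, io a + io a = 0 := by decide
    simp only [T, add_assoc, this, add_zero]

lemma q8_T {m : ℕ} (u : Fin m → ZMod 2 × ZMod 2) (x : FQF m) : q8 (T u x) = q8 x := by
  have hB : B x.1 (sc u x • u) = sc u x * B x.1 u := by rw [B_comm, B_smul_left, B_comm]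
  simp only [q8, T, Q_add, Q_smul, hB]
  unfold sc
  generalize B x.1 u = b
  generalize Q x.1 = a
  generalize Q u = k
  generalize x.2 = c
  revert a b c k; decide

lemma inOrbit_T {m : ℕ} (u : Fin m → ZMod 2 × ZMod 2) (x : FQF m) : inOrbit x (T u x) :=
  ⟨{ toFun := T u, invFun := T u, left_inv := T_T u, right_inv := T_T u, map_add' := T_add u },
    fun z => (q_iff _ _).mpr (q8_T u z), rfl⟩

lemma inOrbit_neg {m : ℕ} (x : FQF m) : inOrbit x (-x) := by
  refine ⟨AddEquiv.neg _, fun z => (q_iff _ _).mpr ?_, rfl⟩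
  have h : (-z).1 = z.1 := by
    rw [Prod.fst_neg, neg_eq_iff_add_eq_zero, add_self_V]
  have h2 : ∀ a c, cmb a (-c) = cmb a c := by decide
  change q8 (-z) = q8 z
  unfold q8
  rw [h, Prod.snd_neg, h2]

lemma inOrbit_refl {m : ℕ} (x : FQF m) : inOrbit x x := ⟨AddEquiv.refl _, fun _ => rfl, rfl⟩

lemma inOrbit_trans {m : ℕ} {x y z : FQF m} (h : inOrbit x y) (h' : inOrbit y z) :
    inOrbit x z := by
  obtain ⟨s, hs, rfl⟩ := h
  obtain ⟨t, ht, rfl⟩ := h'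
  exact ⟨s.trans t, fun w => by simp [hs, ht], rfl⟩

/-- one reflection step -/
lemma step {m : ℕ} (x y : FQF m) (hq : q8 x = q8 y) (ho : rd x.2 ≠ 0)
    (h2 : y.2 = x.2 + io (1 + B x.1 y.1)) : inOrbit x y := by
  have : y = T (x.1 + y.1) x := by
    have hb : B x.1 (x.1 + y.1) = B x.1 y.1 := by
      rw [B_comm, B_add_left, B_self, zero_add, B_comm]
    have hs : sc (x.1 + y.1) x = 1 ∧ y.2 = x.2 + io (1 + Q (x.1 + y.1)) := by
      unfold sc
      unfold q8 at hq
      rw [hb, Q_add]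
      rw [h2] at hq ⊢
      revert hq ho
      generalize B x.1 y.1 = b
      generalize Q x.1 = a
      generalize Q y.1 = k
      generalize x.2 = c
      revert a b c k; decide
    unfold T
    rw [hs.1, one_smul, one_mul, ← hs.2, ← add_assoc, add_self_V, zero_add]
  rw [this]
  exact inOrbit_T _ _

lemma even_case : ∀ (c : ZMod 4), rd c = 0 → (c = 0 ∨ c = 2) := by decide

lemma fst_ne {m : ℕ} (x : FQF m) (h0 : x ≠ 0) (h2 : x ≠ gElt m + gElt m) (he : rd x.2 = 0) :
    x.1 ≠ 0 := by
  intro h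
  rcases even_case _ he with h' | h'
  · exact h0 (Prod.ext h h')
  · exact h2 (Prod.ext (by simp [gElt, h]) (by rw [h']; rfl))

lemma step_even {m : ℕ} (x y : FQF m) (hq : q8 x = q8 y) (he : rd x.2 = 0)
    (hb : B x.1 y.1 = 1) : inOrbit x y := by
  apply inOrbit_trans (inOrbit_refl x)
  have hQ : Q (x.1 + y.1) = Q x.1 + Q y.1 + 1 := by rw [Q_add, hb]
  have : y = T (x.1 + y.1) x := by
    have hb' : B x.1 (x.1 + y.1) = 1 := by
      rw [B_comm, B_add_left, B_self, zero_add, B_comm, hb]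
    have hs : sc (x.1 + y.1) x = 1 ∧ y.2 = x.2 + io (1 + Q (x.1 + y.1)) := by
      unfold sc
      unfold q8 at hq
      rw [hb', hQ]
      revert hq he
      generalize Q x.1 = a
      generalize Q y.1 = k
      generalize x.2 = c
      generalize y.2 = d
      revert a c d k; decide
    unfold T
    rw [hs.1, one_smul, one_mul, ← hs.2, ← add_assoc, add_self_V, zero_add]
  rw [this]
  exact inOrbit_T _ _

lemma exists_c : ∀ (s a : ZMod 2) (c : ZMod 4), rd c = 0 → ∃ d, cmb s d = cmb a c := by decide

lemma rd_of_q : ∀ (a b : ZMod 2) (c d : ZMod 4), cmb a c = cmb b d → rd c = rd d := by decide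

lemma orbit_iff {m : ℕ} (x y : FQF m) : inOrbit x y ↔
    q8 x = q8 y ∧ (x = 0 ↔ y = 0) ∧ (x = gElt m + gElt m ↔ y = gElt m + gElt m) := by
  constructor
  · rintro ⟨s, hs, rfl⟩
    refine ⟨((q_iff _ _).mp (hs x)).symm, by simp, ?_⟩
    have hg : s (gElt m + gElt m) = gElt m + gElt m := by
      have h1 := (q_iff _ _).mp (hs (gElt m))
      have h2 := rd_of_q _ _ _ _ h1
      rw [map_add]
      ext1
      · rw [Prod.fst_add, Prod.fst_add, add_self_V, add_self_V]
      · rw [Prod.snd_add, Prod.snd_add]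
        revert h2
        generalize (s (gElt m)).2 = c
        change rd c = rd 1 → c + c = 1 + 1
        revert c; decide
    conv_rhs => rw [← hg]
    exact s.injective.eq_iff.symm
  · rintro ⟨hq, h0, h2⟩
    have hr := rd_of_q _ _ _ _ hq
    by_cases he : rd x.2 = 0
    · by_cases hx0 : x = 0
      · rw [h0.mp hx0, hx0]; exact inOrbit_refl _
      by_cases hx2 : x = gElt m + gElt m
      · rw [h2.mp hx2, hx2]; exact inOrbit_refl _
      have hx := fst_ne x hx0 hx2 he
      have hy := fst_ne y (mt h0.mpr hx0) (mt h2.mpr hx2) (hr ▸ he)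
      obtain ⟨w, hw1, hw2⟩ := exists_B2 _ _ hx hy
      obtain ⟨d, hd⟩ := exists_c (Q w) (Q x.1) x.2 he
      have hz : q8 ((w, d) : FQF m) = q8 x := hd
      have hrd := rd_of_q _ _ _ _ hz
      exact inOrbit_trans (step_even x (w, d) hz.symm he hw1)
        (step_even (w, d) y (hz.trans hq) (hrd.trans he) (by rw [B_comm]; exact hw2))
    · by_cases h : y.2 = x.2 + io (1 + B x.1 y.1)
      · exact step x y hq he h
      · have hn1 : (-y).1 = y.1 := by
          rw [Prod.fst_neg, neg_eq_iff_add_eq_zero, add_self_V]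
        have := inOrbit_neg (-y)
        rw [neg_neg] at this
        refine inOrbit_trans (step x (-y) ?_ he ?_) this
        · rw [hq]; unfold q8; rw [hn1, Prod.snd_neg]
          have h2 : ∀ a c, cmb a (-c) = cmb a c := by decide
          rw [h2]
        · rw [hn1, Prod.snd_neg]
          revert h he hr
          generalize B x.1 y.1 = b
          generalize x.2 = c
          generalize y.2 = d
          revert b c d; decide

lemma Q_zero (m : ℕ) : Q (0 : Fin m → ZMod 2 × ZMod 2) = 0 := by simp [Q]

lemma Q_e (m : ℕ) : Q (eElt m).1 = 0 := by
  unfold Q eElt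
  refine Finset.sum_eq_zero fun i _ => ?_
  dsimp only
  split_ifs <;> simp

lemma Q_ef (m : ℕ) (hm : 0 < m) : Q (eElt m + fElt m).1 = 1 := by
  unfold Q eElt fElt
  rw [Finset.sum_eq_single ⟨0, hm⟩]
  · simp
  · intro j _ hj
    have : j.val ≠ 0 := fun h => hj (Fin.ext h)
    simp [this]
  · simp

lemma q8_0 (m : ℕ) : q8 (0 : FQF m) = 0 := by
  unfold q8; rw [Prod.fst_zero, Q_zero]; change cmb 0 0 = 0; decide
lemma q8_2g (m : ℕ) : q8 (gElt m + gElt m) = 4 := by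
  have : gElt m + gElt m = (0, 2) := by
    ext1
    · simp [gElt]
    · rfl
  unfold q8; rw [this, Q_zero]; change cmb 0 2 = 4; decide
lemma q8_e (m : ℕ) : q8 (eElt m) = 0 := by
  unfold q8; rw [Q_e]; change cmb 0 0 = 0; decide
lemma q8_ef (m : ℕ) (hm : 0 < m) : q8 (eElt m + fElt m) = 4 := by
  unfold q8; rw [Q_ef m hm]; change cmb 1 (0 + 0) = 4; decide
lemma q8_g (m : ℕ) : q8 (gElt m) = 1 := by
  unfold q8; change cmb (Q 0) 1 = 1; rw [Q_zero]; decide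
lemma q8_efg (m : ℕ) (hm : 0 < m) : q8 (eElt m + fElt m + gElt m) = 5 := by
  have : (eElt m + fElt m + gElt m).1 = (eElt m + fElt m).1 := by
    simp [gElt]
  unfold q8; rw [this, Q_ef m hm]; change cmb 1 (0 + 0 + 1) = 5; decide

lemma e_ne (m : ℕ) (hm : 0 < m) : (eElt m).1 ≠ 0 := by
  intro h
  have := congrFun h ⟨0, hm⟩
  simp [eElt] at this

lemma ef_ne (m : ℕ) (hm : 0 < m) : (eElt m + fElt m).1 ≠ 0 := by
  intro h
  have := Q_ef m hm
  rw [h, Q_zero] at this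
  exact absurd this (by decide)

lemma eq0_fst {m : ℕ} {x : FQF m} (h : x = 0) : x.1 = 0 := by rw [h]; rfl
lemma eq2_fst {m : ℕ} {x : FQF m} (h : x = gElt m + gElt m) : x.1 = 0 := by rw [h]; simp [gElt]

lemma orb_0 {m : ℕ} (x : FQF m) : inOrbit 0 x ↔ x = 0 := by
  rw [orbit_iff]
  refine ⟨fun h => h.2.1.mp rfl, ?_⟩
  rintro rfl; simp
lemma orb_2g {m : ℕ} (x : FQF m) : inOrbit (gElt m + gElt m) x ↔ x = gElt m + gElt m := by
  rw [orbit_iff]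
  refine ⟨fun h => h.2.2.mp rfl, ?_⟩
  rintro rfl; simp

lemma ne_of_q {m : ℕ} {x y : FQF m} {a b : ZMod 8} (h : q8 x = a) (h' : q8 y = b) (hab : a ≠ b) :
    x ≠ y := by
  rintro rfl; exact hab (h.symm.trans h')

lemma fst_ne_iff {m : ℕ} (x : FQF m) (h : q8 x = 0 ∨ q8 x = 4) :
    x.1 ≠ 0 ↔ x ≠ 0 ∧ x ≠ gElt m + gElt m := by
  constructor
  · exact fun h => ⟨fun h' => h (eq0_fst h'), fun h' => h (eq2_fst h')⟩
  · rintro ⟨h0, h2⟩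
    refine fst_ne x h0 h2 ?_
    revert h; unfold q8
    generalize Q x.1 = a
    generalize x.2 = c
    revert a c; decide

lemma orb_even {m : ℕ} (r x : FQF m) (h : q8 r = 0 ∨ q8 r = 4) (hr : r.1 ≠ 0) :
    inOrbit r x ↔ q8 x = q8 r ∧ x.1 ≠ 0 := by
  rw [orbit_iff]
  have h1 := (fst_ne_iff r h).mp hr
  constructor
  · rintro ⟨hq, h0, h2⟩
    exact ⟨hq.symm, (fst_ne_iff x (hq ▸ h)).mpr ⟨mt h0.mpr h1.1, mt h2.mpr h1.2⟩⟩
  · rintro ⟨hq, hx⟩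
    have h2 := (fst_ne_iff x (hq ▸ h)).mp hx
    exact ⟨hq.symm, by simp [h1.1, h2.1], by simp [h1.2, h2.2]⟩

lemma orb_odd {m : ℕ} (r x : FQF m) (h : q8 r = 1 ∨ q8 r = 5) :
    inOrbit r x ↔ q8 x = q8 r := by
  have key : ∀ y : FQF m, (q8 y = 1 ∨ q8 y = 5) → y ≠ 0 ∧ y ≠ gElt m + gElt m := by
    intro y hy
    constructor
    · rintro rfl; rw [q8_0] at hy; revert hy; decide
    · rintro rfl; rw [q8_2g] at hy; revert hy; decide
  rw [orbit_iff]
  constructor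
  · exact fun h => h.1.symm
  · intro hq
    have h1 := key r h
    have h2 := key x (hq ▸ h)
    exact ⟨hq.symm, by simp [h1.1, h2.1], by simp [h1.2, h2.2]⟩

lemma card_V (m : ℕ) : Nat.card (Fin m → ZMod 2 × ZMod 2) = 2 ^ (2 * m) := by
  simp [pow_mul]

lemma card_even {m : ℕ} (k : ZMod 8) (hk : k = 0 ∨ k = 4) :
    Nat.card {x : FQF m // q8 x = k ∧ x.1 ≠ 0} = 2 ^ (2 * m) - 1 := by
  have h : Nat.card {v : Fin m → ZMod 2 × ZMod 2 // v ≠ 0} = 2 ^ (2 * m) - 1 := by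
    classical
    rw [Nat.card_eq_fintype_card, Fintype.card_subtype_compl, Fintype.card_subtype_eq,
      ← Nat.card_eq_fintype_card, card_V]
  rw [← h]
  refine Nat.card_eq_of_bijective (fun x => ⟨x.1.1, x.2.2⟩) ⟨?_, ?_⟩
  · rintro ⟨⟨v, c⟩, h1, h1'⟩ ⟨⟨w, d⟩, h2, h2'⟩ hvw
    have hvw : v = w := congrArg Subtype.val hvw
    subst hvw
    have : c = d := by
      have key : ∀ (k : ZMod 8) (a : ZMod 2) (c d : ZMod 4), (k = 0 ∨ k = 4) →
          cmb a c = k → cmb a d = k → c = d := by decide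
      exact key k (Q v) c d hk h1 h2
    subst this; rfl
  · rintro ⟨v, hv⟩
    have : ∀ a : ZMod 2, ∃ c, cmb a c = k := by revert k; decide
    obtain ⟨c, hc⟩ := this (Q v)
    exact ⟨⟨(v, c), hc, hv⟩, rfl⟩

/-- the sign character -/
def sg (a : ZMod 2) : ℤ := if a = 0 then 1 else -1

lemma sum_sg (m : ℕ) : ∑ v : Fin m → ZMod 2 × ZMod 2, sg (Q v) = 2 ^ m := by
  have hadd : ∀ a b, sg (a + b) = sg a * sg b := by decide
  have hprod : ∀ v : Fin m → ZMod 2 × ZMod 2, sg (Q v) = ∏ i, sg ((v i).1 * (v i).2) := by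
    intro v
    unfold Q
    induction (Finset.univ : Finset (Fin m)) using Finset.induction_on with
    | empty => simp [sg]
    | insert a s ha ih => rw [Finset.sum_insert ha, Finset.prod_insert ha, hadd, ih]
  simp_rw [hprod]
  rw [← Fintype.prod_sum (fun (_ : Fin m) (p : ZMod 2 × ZMod 2) => sg (p.1 * p.2))]
  have : ∑ p : ZMod 2 × ZMod 2, sg (p.1 * p.2) = 2 := by decide
  simp [this]

lemma card_Q (m : ℕ) (a : ZMod 2) :
    2 * (Nat.card {v : Fin m → ZMod 2 × ZMod 2 // Q v = a} : ℤ) = 2 ^ (2 * m) + sg a * 2 ^ m := by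
  classical
  rw [Nat.card_eq_fintype_card, Fintype.card_subtype, Finset.card_filter]
  push_cast
  rw [← sum_sg m, Finset.mul_sum, Finset.mul_sum]
  have : (2 : ℤ) ^ (2 * m) = ∑ v : Fin m → ZMod 2 × ZMod 2, 1 := by
    have := card_V m
    rw [Nat.card_eq_fintype_card] at this
    rw [Finset.sum_const, Finset.card_univ, this]; simp
  rw [this, ← Finset.sum_add_distrib]
  refine Finset.sum_congr rfl fun v _ => ?_
  generalize Q v = b
  revert a b; decide

lemma card_odd {m : ℕ} (a : ZMod 2) :
    (Nat.card {x : FQF m // q8 x = cmb a 1} : ℤ) = 2 ^ (2 * m) + sg a * 2 ^ m := by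
  rw [← card_Q]
  have e : {x : FQF m // q8 x = cmb a 1} ≃
      {v : Fin m → ZMod 2 × ZMod 2 // Q v = a} × {c : ZMod 4 // rd c = 1} :=
    (Equiv.subtypeEquivRight (fun x => by
      unfold q8
      generalize Q x.1 = b
      generalize x.2 = c
      revert a b c; decide)).trans
      (Equiv.subtypeProdEquivProd (p := fun v : Fin m → ZMod 2 × ZMod 2 => Q v = a)
        (q := fun c : ZMod 4 => rd c = 1))
  rw [Nat.card_congr e, Nat.card_prod]
  have : Nat.card {c : ZMod 4 // rd c = 1} = 2 := by
    rw [Nat.card_eq_fintype_card]; decide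
  rw [this]; push_cast; ring

end FQFaux

open FQFaux in
/-- `O(u(2)^m ⊕ ⟨1/4⟩)` has exactly 6 orbits on the underlying
group, with representatives `0, 2g, e, e+f, g, e+f+g` of sizes
`1, 1, 2^{2m}-1, 2^{2m}-1, 2^{2m}+2^m, 2^{2m}-2^m`. -/
theorem orbits_of_finite_quadratic_form (m : ℕ) (hm : 0 < m) :
    (∀ x : FQF m, inOrbit 0 x ∨ inOrbit (gElt m + gElt m) x ∨ inOrbit (eElt m) x ∨
      inOrbit (eElt m + fElt m) x ∨ inOrbit (gElt m) x ∨
      inOrbit (eElt m + fElt m + gElt m) x) ∧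
    ([0, gElt m + gElt m, eElt m, eElt m + fElt m, gElt m,
        eElt m + fElt m + gElt m] : List (FQF m)).Pairwise (fun x y => ¬ inOrbit x y) ∧
    Nat.card {x : FQF m // inOrbit 0 x} = 1 ∧
    Nat.card {x : FQF m // inOrbit (gElt m + gElt m) x} = 1 ∧
    Nat.card {x : FQF m // inOrbit (eElt m) x} = 2 ^ (2 * m) - 1 ∧
    Nat.card {x : FQF m // inOrbit (eElt m + fElt m) x} = 2 ^ (2 * m) - 1 ∧
    Nat.card {x : FQF m // inOrbit (gElt m) x} = 2 ^ (2 * m) + 2 ^ m ∧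
    Nat.card {x : FQF m // inOrbit (eElt m + fElt m + gElt m) x} = 2 ^ (2 * m) - 2 ^ m := by
  have E : ∀ x : FQF m, inOrbit (eElt m) x ↔ q8 x = 0 ∧ x.1 ≠ 0 := fun x => by
    rw [orb_even _ _ (Or.inl (q8_e m)) (e_ne m hm), q8_e]
  have EF : ∀ x : FQF m, inOrbit (eElt m + fElt m) x ↔ q8 x = 4 ∧ x.1 ≠ 0 := fun x => by
    rw [orb_even _ _ (Or.inr (q8_ef m hm)) (ef_ne m hm), q8_ef m hm]
  have G : ∀ x : FQF m, inOrbit (gElt m) x ↔ q8 x = 1 := fun x => by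
    rw [orb_odd _ _ (Or.inl (q8_g m)), q8_g]
  have EFG : ∀ x : FQF m, inOrbit (eElt m + fElt m + gElt m) x ↔ q8 x = 5 := fun x => by
    rw [orb_odd _ _ (Or.inr (q8_efg m hm)), q8_efg m hm]
  simp only [orb_0, orb_2g, E, EF, G, EFG]
  refine ⟨?_, ?_, ?_, ?_, card_even 0 (Or.inl rfl), card_even 4 (Or.inr rfl), ?_, ?_⟩
  · intro x
    have hv : q8 x = 0 ∨ q8 x = 4 ∨ q8 x = 1 ∨ q8 x = 5 := by
      unfold q8
      generalize Q x.1 = a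
      generalize x.2 = c
      revert a c; decide
    by_cases h0 : x = 0
    · exact Or.inl h0
    by_cases h2 : x = gElt m + gElt m
    · exact Or.inr (Or.inl h2)
    rcases hv with h | h | h | h
    · exact Or.inr (Or.inr (Or.inl ⟨h, (fst_ne_iff x (Or.inl h)).mpr ⟨h0, h2⟩⟩))
    · exact Or.inr (Or.inr (Or.inr (Or.inl ⟨h, (fst_ne_iff x (Or.inr h)).mpr ⟨h0, h2⟩⟩)))
    · exact Or.inr (Or.inr (Or.inr (Or.inr (Or.inl h))))
    · exact Or.inr (Or.inr (Or.inr (Or.inr (Or.inr h))))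
  · have n04 : (0 : ZMod 8) ≠ 4 := by decide
    have n01 : (0 : ZMod 8) ≠ 1 := by decide
    have n05 : (0 : ZMod 8) ≠ 5 := by decide
    have n41 : (4 : ZMod 8) ≠ 1 := by decide
    have n45 : (4 : ZMod 8) ≠ 5 := by decide
    have n15 : (1 : ZMod 8) ≠ 5 := by decide
    have a0 := q8_0 m
    have a1 := q8_2g m
    have a2 := q8_e m
    have a3 := q8_ef m hm
    have a4 := q8_g m
    have a5 := q8_efg m hm
    have b1 := e_ne m hm
    have b2 := ef_ne m hm
    simp only [List.pairwise_cons, List.mem_cons, List.not_mem_nil, or_false, forall_eq_or_imp,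
      forall_eq, List.Pairwise.nil, and_true, orb_0, orb_2g, E, EF, G, EFG, IsEmpty.forall_iff,
      implies_true, a3, a4, a5]
    refine ⟨⟨(ne_of_q a0 a1 n04).symm, fun h => b1 (eq0_fst h), fun h => b2 (eq0_fst h),
      (ne_of_q a0 a4 n01).symm, (ne_of_q a0 a5 n05).symm⟩,
      ⟨fun h => b1 (eq2_fst h), fun h => b2 (eq2_fst h), (ne_of_q a1 a4 n41).symm,
        (ne_of_q a1 a5 n45).symm⟩, ?_, ?_, ?_⟩
    · exact ⟨fun h => n04 h.1.symm, fun h => n01 h.1.symm, fun h => n05 h.1.symm⟩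
    · exact ⟨fun h => n41 h.1.symm, fun h => n45 h.1.symm⟩
    · exact n15.symm
  · simp
  · simp
  · have h := card_odd (m := m) 0
    rw [show cmb 0 1 = 1 by decide, show sg 0 = 1 by decide, one_mul] at h
    exact_mod_cast h
  · have h := card_odd (m := m) 1
    rw [show cmb 1 1 = 5 by decide, show sg 1 = -1 by decide] at h
    have h' : Nat.card {x : FQF m // q8 x = 5} + 2 ^ m = 2 ^ (2 * m) := by
      have : (Nat.card {x : FQF m // q8 x = 5} : ℤ) + 2 ^ m = 2 ^ (2 * m) := by rw [h]; ring
      exact_mod_cast this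
    omega
end

section
/- The orthogonal group O(u(2)^{⊕3} ⊕ ⟨1/4⟩) of the finite quadratic form u(2)^{⊕3} ⊕ ⟨1/4⟩ has order 2^{10} · 3^4 · 5 · 7. -/
/-- Underlying group of the finite quadratic form `u(2)^3 ⊕ ⟨1/4⟩`. -/
abbrev T3 : Type := (Fin 3 → ZMod 2 × ZMod 2) × ZMod 4

/-- The quadratic form `u(2)^3 ⊕ ⟨1/4⟩` with values in `ℚ/2ℤ`:
`q(e)=q(f)=0`, `b(e,f)=1/2` on each `u(2)` summand, `q(g)=1/4` on `ℤ/4`. -/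
def qT3 (x : T3) : AddCircle (2 : ℚ) :=
  (((∑ i, ((x.1 i).1.val : ℚ) * ((x.1 i).2.val : ℚ)) + ((x.2.val : ℚ))^2 / 4 : ℚ) :
    AddCircle (2 : ℚ))

/-- Numerator of the quadratic form (in units of `1/4`). -/
def nT3 (x : T3) : ℕ :=
  4 * ((x.1 0).1.val * (x.1 0).2.val + (x.1 1).1.val * (x.1 1).2.val
    + (x.1 2).1.val * (x.1 2).2.val) + x.2.val ^ 2

/-- The form with values in `ZMod 8`. -/
def q8 (x : T3) : ZMod 8 := (nT3 x : ZMod 8)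

/-- Its polar form. -/
def B8 (x y : T3) : ZMod 8 := q8 (x + y) - q8 x - q8 y

theorem qT3_eq_iff (x y : T3) : qT3 x = qT3 y ↔ q8 x = q8 y := by
  have key : ∀ z : T3, qT3 z = (((nT3 z : ℚ) / 4 : ℚ) : AddCircle (2 : ℚ)) := by
    intro z
    unfold qT3 nT3
    congr 1
    rw [Fin.sum_univ_three]
    push_cast
    ring
  rw [key, key, QuotientAddGroup.eq, AddSubgroup.mem_zmultiples_iff]
  unfold q8
  rw [show ((nT3 x : ZMod 8) = (nT3 y : ZMod 8)) ↔
    (((nT3 x : ℤ) : ZMod 8) = ((nT3 y : ℤ) : ZMod 8)) by push_cast; rfl,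
    ZMod.intCast_eq_intCast_iff_dvd_sub]
  constructor
  · rintro ⟨k, hk⟩
    refine ⟨k, ?_⟩
    rw [zsmul_eq_mul] at hk
    have : ((nT3 y : ℚ) - nT3 x) = 8 * k := by linarith
    exact_mod_cast this
  · rintro ⟨k, hk⟩
    refine ⟨k, ?_⟩
    have : ((nT3 y : ℚ) - nT3 x) = 8 * k := by exact_mod_cast hk
    rw [zsmul_eq_mul]
    linarith

/-- polar form of one hyperbolic component -/
def bc (p r : ZMod 2 × ZMod 2) : ZMod 8 :=
  4 * (((p + r).1.val : ZMod 8) * ((p + r).2.val : ZMod 8)) - 4 * ((p.1.val : ZMod 8) * (p.2.val : ZMod 8))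
    - 4 * ((r.1.val : ZMod 8) * (r.2.val : ZMod 8))

/-- polar form of the last component -/
def bt (p r : ZMod 4) : ZMod 8 :=
  ((p + r).val : ZMod 8) ^ 2 - (p.val : ZMod 8) ^ 2 - (r.val : ZMod 8) ^ 2

theorem bc_add : ∀ p p' r, bc (p + p') r = bc p r + bc p' r := by decide +kernel
theorem bc_two : ∀ p r, 2 * bc p r = 0 := by decide +kernel
theorem bt_add : ∀ p p' r, bt (p + p') r = bt p r + bt p' r := by decide +kernel
theorem bt_two : ∀ p r, r + r = 0 → 2 * bt p r = 0 := by decide +kernel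

theorem B8_eq (x y : T3) : B8 x y =
    bc (x.1 0) (y.1 0) + bc (x.1 1) (y.1 1) + bc (x.1 2) (y.1 2) + bt x.2 y.2 := by
  simp only [B8, q8, nT3, bc, bt, Prod.fst_add, Prod.snd_add, Pi.add_apply]
  push_cast
  ring

theorem B8_add (x y r : T3) : B8 (x + y) r = B8 x r + B8 y r := by
  simp only [B8_eq, Prod.fst_add, Prod.snd_add, Pi.add_apply, bc_add, bt_add]
  ring

theorem B8_comm (x y : T3) : B8 x y = B8 y x := by
  unfold B8; rw [add_comm]; ring

theorem B8_cases (x r : T3) (hr : r + r = 0) : B8 x r = 0 ∨ B8 x r = 4 := by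
  have h : 2 * B8 x r = 0 := by
    rw [B8_eq]
    have h1 := bc_two (x.1 0) (r.1 0)
    have h2 := bc_two (x.1 1) (r.1 1)
    have h3 := bc_two (x.1 2) (r.1 2)
    have h4 := bt_two x.2 r.2 (congrArg Prod.snd hr)
    linear_combination h1 + h2 + h3 + h4
  revert h
  generalize B8 x r = b
  revert b
  decide

theorem q8_zero : q8 0 = 0 := by decide +kernel

theorem B8_self (r : T3) (hr : r + r = 0) (hq : q8 r = 4) : B8 r r = 0 := by
  unfold B8; rw [hr, hq, q8_zero]; decide

theorem z84 : (4 : ZMod 8) + 4 = 0 := by decide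
theorem z04 : (0 : ZMod 8) ≠ 4 := by decide

/-- The reflection map. -/
def reflFun (r x : T3) : T3 := x + if B8 x r = 4 then r else 0

theorem reflFun_add (r : T3) (hr : r + r = 0) (x y : T3) :
    reflFun r (x + y) = reflFun r x + reflFun r y := by
  unfold reflFun
  rw [B8_add]
  rcases B8_cases x r hr with h | h <;> rcases B8_cases y r hr with h' | h' <;>
    simp only [h, h', z84, z04, add_zero, zero_add, if_true, if_false]
  · abel
  · abel
  · rw [add_add_add_comm, hr, add_zero]

theorem reflFun_invol (r : T3) (hr : r + r = 0) (hq : q8 r = 4) (x : T3) :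
    reflFun r (reflFun r x) = x := by
  unfold reflFun
  rcases B8_cases x r hr with h | h
  · simp only [h, z04, if_false, add_zero]
  · simp only [h, if_true, B8_add, B8_self r hr hq, add_zero]
    rw [add_assoc, hr, add_zero]

theorem reflFun_q (r : T3) (hr : r + r = 0) (hq : q8 r = 4) (x : T3) :
    q8 (reflFun r x) = q8 x := by
  unfold reflFun
  rcases B8_cases x r hr with h | h
  · simp only [h, z04, if_false, add_zero]
  · simp only [h, if_true]
    have := h
    unfold B8 at this
    rw [hq] at this
    have h8 := z84
    linear_combination this + h8

/-- The reflection as an automorphism. -/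
def refl8 (r : T3) (hr : r + r = 0) (hq : q8 r = 4) : T3 ≃+ T3 where
  toFun := reflFun r
  invFun := reflFun r
  left_inv := reflFun_invol r hr hq
  right_inv := reflFun_invol r hr hq
  map_add' := reflFun_add r hr

/-- Isometries fixing the list `L`. -/
def GL8 (L : List T3) (σ : T3 ≃+ T3) : Prop :=
  (∀ z, q8 (σ z) = q8 z) ∧ ∀ l ∈ L, σ l = l

theorem GL8.trans {L : List T3} {σ τ : T3 ≃+ T3} (h : GL8 L σ) (h' : GL8 L τ) :
    GL8 L (σ.trans τ) :=
  ⟨fun z => by simp [h.1, h'.1], fun l hl => by simp [h.2 l hl, h'.2 l hl]⟩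

theorem GL8.symm {L : List T3} {σ : T3 ≃+ T3} (h : GL8 L σ) : GL8 L σ.symm :=
  ⟨fun z => by rw [← h.1]; simp, fun l hl => by rw [AddEquiv.symm_apply_eq, h.2 l hl]⟩

theorem GL8.B {L : List T3} {σ : T3 ≃+ T3} (h : GL8 L σ) (x y : T3) :
    B8 (σ x) (σ y) = B8 x y := by
  unfold B8; rw [← map_add, h.1, h.1, h.1]

/-- Nested-product coordinates. -/
abbrev T3' : Type := ZMod 2 × ZMod 2 × ZMod 2 × ZMod 2 × ZMod 2 × ZMod 2 × ZMod 4

instance decEqT3' : DecidableEq T3' :=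
  letI _d2 : DecidableEq (ZMod 2) := ZMod.decidableEq 2
  letI _d4 : DecidableEq (ZMod 4) := ZMod.decidableEq 4
  letI _i1 : DecidableEq (ZMod 2 × ZMod 4) := instDecidableEqProd
  letI _i2 : DecidableEq (ZMod 2 × ZMod 2 × ZMod 4) := instDecidableEqProd
  letI _i3 : DecidableEq (ZMod 2 × ZMod 2 × ZMod 2 × ZMod 4) := instDecidableEqProd
  letI _i4 : DecidableEq (ZMod 2 × ZMod 2 × ZMod 2 × ZMod 2 × ZMod 4) := instDecidableEqProd
  letI _i5 : DecidableEq (ZMod 2 × ZMod 2 × ZMod 2 × ZMod 2 × ZMod 2 × ZMod 4) :=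
    instDecidableEqProd
  instDecidableEqProd

/-- Coordinates. -/
def e8 : T3' ≃ T3 where
  toFun p := (![(p.1, p.2.1), (p.2.2.1, p.2.2.2.1), (p.2.2.2.2.1, p.2.2.2.2.2.1)], p.2.2.2.2.2.2)
  invFun x := ((x.1 0).1, (x.1 0).2, (x.1 1).1, (x.1 1).2, (x.1 2).1, (x.1 2).2, x.2)
  left_inv p := rfl
  right_inv x := by
    refine Prod.ext ?_ rfl
    funext i
    fin_cases i <;> rfl

/-- Candidate images of `x` under isometries fixing `L`. -/
def S8 (L : List T3) (x y : T3) : Prop :=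
  q8 y = q8 x ∧ e8.symm y ≠ 0 ∧ ∀ l ∈ L, B8 l y = B8 l x

instance (L : List T3) (x y : T3) : Decidable (S8 L x y) := by unfold S8; infer_instance

theorem e8_symm_eq_zero (y : T3) : e8.symm y = 0 ↔ y = 0 := by
  rw [Equiv.symm_apply_eq]
  have : e8 0 = 0 := by decide +kernel
  rw [this]

theorem GL8.S {L : List T3} {σ : T3 ≃+ T3} (h : GL8 L σ) (x : T3) (hx : x ≠ 0) :
    S8 L x (σ x) := by
  refine ⟨h.1 x, ?_, fun l hl => ?_⟩
  · rw [Ne, e8_symm_eq_zero]; simpa using hx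
  · rw [← h.B l x, h.2 l hl]

theorem level8 (L : List T3) (x : T3) (hx : x ≠ 0) (n : ℕ)
    (hn : (Finset.univ.filter fun p : T3' => S8 L x (e8 p)).card = n)
    (ht : ∀ y, S8 L x y → ∃ σ, GL8 L σ ∧ σ x = y) :
    Nat.card {σ // GL8 L σ} = n * Nat.card {σ // GL8 (x :: L) σ} := by
  have hc : Nat.card {y // S8 L x y} = n := by
    rw [← hn, ← Fintype.card_subtype, ← Nat.card_eq_fintype_card]
    exact Nat.card_congr (e8.subtypeEquiv fun p => Iff.rfl).symm
  rw [← hc, ← Nat.card_prod]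
  choose τ hτ hτx using ht
  refine Nat.card_congr
    { toFun := fun σ => (⟨σ.1 x, σ.2.S x hx⟩,
        ⟨σ.1.trans (τ (σ.1 x) (σ.2.S x hx)).symm, (σ.2.trans (hτ _ _).symm).1, ?_⟩)
      invFun := fun p => ⟨p.2.1.trans (τ p.1.1 p.1.2), GL8.trans
        ⟨p.2.2.1, fun l hl => p.2.2.2 l (List.mem_cons_of_mem _ hl)⟩ (hτ _ _)⟩
      left_inv := ?_
      right_inv := ?_ }
  · intro l hl
    rcases List.mem_cons.1 hl with rfl | hl
    · simp [AddEquiv.symm_apply_eq, hτx]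
    · exact (σ.2.trans (hτ _ _).symm).2 l hl
  · intro σ
    ext1
    apply AddEquiv.ext
    intro z
    simp
  · rintro ⟨⟨y, hy⟩, ⟨ρ, hρ⟩⟩
    have h1 : ρ x = x := hρ.2 x (by simp)
    have h2 : (ρ.trans (τ y hy)) x = y := by simp [h1, hτx]
    refine Prod.ext (Subtype.ext h2) (Subtype.ext ?_)
    apply AddEquiv.ext
    intro z
    simp only [AddEquiv.trans_apply, AddEquiv.symm_apply_eq]
    congr 2
    simp [h1, hτx]

theorem swap8 (L : List T3) (x y : T3) (hx : x + x = 0) (hy : y + y = 0) (qx : q8 x = 0)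
    (qy : q8 y = 0) (hxy : B8 x y = 4) (hL : ∀ l ∈ L, B8 l y = B8 l x) :
    ∃ σ, GL8 L σ ∧ σ x = y := by
  have hr : (x + y) + (x + y) = 0 := by rw [add_add_add_comm, hx, hy, add_zero]
  have hq : q8 (x + y) = 4 := by
    have := hxy
    unfold B8 at this
    rw [qx, qy] at this
    simpa using this
  refine ⟨refl8 (x + y) hr hq, ⟨reflFun_q _ hr hq, fun l hl => ?_⟩, ?_⟩
  · have h : B8 l (x + y) = 0 := by
      rw [B8_comm, B8_add, B8_comm x, B8_comm y, hL l hl]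
      rcases B8_cases l x hx with h | h <;> rw [h] <;> decide
    change l + (if B8 l (x + y) = 4 then (x + y) else 0) = l
    rw [h, if_neg z04, add_zero]
  · have h : B8 x (x + y) = 4 := by
      rw [B8_comm, B8_add, B8_comm y, hxy]
      have : B8 x x = 0 := by unfold B8; rw [hx, qx, q8_zero]; decide
      rw [this, zero_add]
    change x + (if B8 x (x + y) = 4 then (x + y) else 0) = y
    rw [h, if_pos rfl, ← add_assoc, hx, zero_add]

/-- Transitivity certificate. -/
theorem trans8 (L : List T3) (x : T3) (hx : x + x = 0) (qx : q8 x = 0)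
    (h2 : ∀ p, S8 L x (e8 p) → p + p = 0)
    (h : ∀ p, S8 L x (e8 p) → e8 p = x ∨ B8 x (e8 p) = 4 ∨
      ∃ r, B8 x (e8 r) = 4 ∧ B8 (e8 r) (e8 p) = 4 ∧ S8 L x (e8 r)) (y : T3) (hy : S8 L x y) :
    ∃ σ, GL8 L σ ∧ σ x = y := by
  have hd : ∀ y, S8 L x y → y + y = 0 := by
    intro y hy
    have h0 := h2 (e8.symm y) (by simpa using hy)
    rw [← e8_symm_eq_zero]
    exact h0
  have hq : ∀ y, S8 L x y → q8 y = 0 := fun y hy => hy.1.trans qx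
  rcases h (e8.symm y) (by simpa using hy) with h | h | ⟨r, h, h', hr⟩
  · refine ⟨AddEquiv.refl _, ⟨fun _ => rfl, fun _ _ => rfl⟩, ?_⟩
    simpa using h.symm
  · rw [Equiv.apply_symm_apply] at h
    exact swap8 L x y hx (hd y hy) qx (hq y hy) h hy.2.2
  · rw [Equiv.apply_symm_apply] at h'
    obtain ⟨σ, hσ, hσx⟩ := swap8 L x (e8 r) hx (hd _ hr) qx (hq _ hr) h hr.2.2
    obtain ⟨τ, hτ, hτx⟩ := swap8 L (e8 r) y (hd _ hr) (hd y hy) (hq _ hr) (hq y hy) h'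
      (fun l hl => (hy.2.2 l hl).trans (hr.2.2 l hl).symm)
    exact ⟨σ.trans τ, hσ.trans hτ, by simp [hσx, hτx]⟩

/-- Generators. -/
def vg : T3 := e8 (0, 0, 0, 0, 0, 0, 1)
/-- Generators. -/
def ve (i : Fin 3) : T3 := (Pi.single i (1, 0), 0)
/-- Generators. -/
def vf (i : Fin 3) : T3 := (Pi.single i (0, 1), 0)

theorem transg (y : T3) (hy : S8 [vf 2, ve 2, vf 1, ve 1, vf 0, ve 0] vg y) :
    ∃ σ, GL8 [vf 2, ve 2, vf 1, ve 1, vf 0, ve 0] σ ∧ σ vg = y := by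
  have key : ∀ p : T3', S8 [vf 2, ve 2, vf 1, ve 1, vf 0, ve 0] vg (e8 p) →
      p = e8.symm vg ∨ p = e8.symm (vg + (vg + vg)) := by decide +kernel
  have hr : (vg + vg) + (vg + vg) = 0 := by
    rw [← e8_symm_eq_zero]; decide +kernel
  have hq : q8 (vg + vg) = 4 := by decide +kernel
  rcases key (e8.symm y) (by simpa using hy) with h | h
  · exact ⟨AddEquiv.refl _, ⟨fun _ => rfl, fun _ _ => rfl⟩, (e8.symm.injective h).symm⟩
  · refine ⟨refl8 _ hr hq, ⟨reflFun_q _ hr hq, fun l hl => ?_⟩, ?_⟩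
    · have hB : ∀ l ∈ [vf 2, ve 2, vf 1, ve 1, vf 0, ve 0], B8 l (vg + vg) = 0 := by
        decide +kernel
      change l + (if B8 l (vg + vg) = 4 then (vg + vg) else 0) = l
      rw [hB l hl, if_neg z04, add_zero]
    · rw [e8.symm.injective h]
      change vg + (if B8 vg (vg + vg) = 4 then (vg + vg) else 0) = _
      rw [if_pos (by decide +kernel)]

theorem final8 : Nat.card {σ // GL8 [vg, vf 2, ve 2, vf 1, ve 1, vf 0, ve 0] σ} = 1 := by
  rw [Nat.card_eq_one_iff_unique]
  refine ⟨⟨fun σ τ => ?_⟩, ⟨⟨AddEquiv.refl _, fun _ => rfl, fun _ _ => rfl⟩⟩⟩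
  have key : ∀ σ : {σ // GL8 [vg, vf 2, ve 2, vf 1, ve 1, vf 0, ve 0] σ}, ∀ z, σ.1 z = z := by
    rintro ⟨σ, hσ⟩ z
    have hz : ∀ p : T3', e8.symm ((p.1.val • ve 0 + p.2.1.val • vf 0) + (p.2.2.1.val • ve 1
      + p.2.2.2.1.val • vf 1) + (p.2.2.2.2.1.val • ve 2
      + p.2.2.2.2.2.1.val • vf 2) + p.2.2.2.2.2.2.val • vg) = p := by decide +kernel
    have hz := hz (e8.symm z)
    rw [e8.symm.injective.eq_iff] at hz
    change σ z = z
    rw [← hz]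
    simp only [map_add, map_nsmul]
    simp only [hσ.2 _ (show ve 0 ∈ _ by simp), hσ.2 _ (show ve 1 ∈ _ by simp),
      hσ.2 _ (show ve 2 ∈ _ by simp), hσ.2 _ (show vf 0 ∈ _ by simp),
      hσ.2 _ (show vf 1 ∈ _ by simp), hσ.2 _ (show vf 2 ∈ _ by simp),
      hσ.2 _ (show vg ∈ _ by simp)]
  ext1
  apply AddEquiv.ext
  intro z
  rw [key, key]

theorem ne8 (x : T3) (h : e8.symm x ≠ 0) : x ≠ 0 := by
  rwa [Ne, ← e8_symm_eq_zero]

/-- the orthogonal group of the finite quadratic form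
`u(2)^3 ⊕ ⟨1/4⟩` has order `2^10 · 3^4 · 5 · 7`. -/
theorem card_O_u2_3_quarter :
    Nat.card {σ : T3 ≃+ T3 // ∀ z : T3, qT3 (σ z) = qT3 z} = 2 ^ 10 * 3 ^ 4 * 5 * 7 := by
  have h0 : Nat.card {σ : T3 ≃+ T3 // ∀ z : T3, qT3 (σ z) = qT3 z} = Nat.card {σ // GL8 [] σ} := by
    refine Nat.card_congr (Equiv.subtypeEquivRight fun σ => ?_)
    simp [GL8, qT3_eq_iff]
  rw [h0,
    level8 [] (ve 0) (ne8 _ (by decide +kernel)) 63 (by decide +kernel)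
      (trans8 _ _ (by decide +kernel) (by decide +kernel) (by decide +kernel) (by decide +kernel)),
    level8 _ (vf 0) (ne8 _ (by decide +kernel)) 32 (by decide +kernel)
      (trans8 _ _ (by decide +kernel) (by decide +kernel) (by decide +kernel) (by decide +kernel)),
    level8 _ (ve 1) (ne8 _ (by decide +kernel)) 15 (by decide +kernel)
      (trans8 _ _ (by decide +kernel) (by decide +kernel) (by decide +kernel) (by decide +kernel)),
    level8 _ (vf 1) (ne8 _ (by decide +kernel)) 8 (by decide +kernel)
      (trans8 _ _ (by decide +kernel) (by decide +kernel) (by decide +kernel) (by decide +kernel)),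
    level8 _ (ve 2) (ne8 _ (by decide +kernel)) 3 (by decide +kernel)
      (trans8 _ _ (by decide +kernel) (by decide +kernel) (by decide +kernel) (by decide +kernel)),
    level8 _ (vf 2) (ne8 _ (by decide +kernel)) 2 (by decide +kernel)
      (trans8 _ _ (by decide +kernel) (by decide +kernel) (by decide +kernel) (by decide +kernel)),
    level8 _ vg (ne8 _ (by decide +kernel)) 2 (by decide +kernel) transg, final8]
  norm_num
end
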